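/- arXiv:1508.03323 — 9 statements merged into one kernel-verified Lean document; each statement's English description precedes it below -/
import Mathlib

section
/- Let d ≥ 1, let X be a real d×d symmetric positive definite matrix and let a ≥ 0 be a real number with a·Tr[X⁻¹] ≠ 1. Then the linear map L_{X,a} : S_d → S_d defined by L_{X,a}(Y) = YX + XY − 2a·Tr[Y]·I_d is bijective on the space S_d of real symmetric d×d matrices (equivalently, its kernel is {0}: if Y is symmetric and YX + XY = 2a·Tr[Y]·I_d then Y = 0). -/
open Matrix

/-- For `X` symmetric positive definite and `a ≥ 0` with
`a · Tr[X⁻¹] ≠ 1`, the linear map `L_{X,a}(Y) = YX + XY − 2a·Tr[Y]·I_d` on the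
space of real symmetric `d × d` matrices has trivial kernel (equivalently, it is
bijective on this finite-dimensional space): if `Y` is symmetric and
`YX + XY = 2a·Tr[Y]·I_d` then `Y = 0`. -/
theorem stmt_0 (d : ℕ) (hd : 1 ≤ d) (X : Matrix (Fin d) (Fin d) ℝ)
    (hX : X.PosDef) (a : ℝ) (ha : 0 ≤ a)
    (ha' : a * Matrix.trace X⁻¹ ≠ 1) :
    ∀ Y : Matrix (Fin d) (Fin d) ℝ, Y.IsSymm →
      Y * X + X * Y = (2 * a * Matrix.trace Y) • (1 : Matrix (Fin d) (Fin d) ℝ) →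
      Y = 0 := by
  intro Y hY h
  have hdet : IsUnit X.det := (Matrix.isUnit_iff_isUnit_det X).mp hX.isUnit
  have hXi : X * X⁻¹ = 1 := Matrix.mul_nonsing_inv X hdet
  have hiX : X⁻¹ * X = 1 := Matrix.nonsing_inv_mul X hdet
  obtain ⟨c, hc⟩ : ∃ c, c = a * Matrix.trace Y := ⟨_, rfl⟩
  obtain ⟨Z, hZ⟩ : ∃ Z, Z = Y - c • X⁻¹ := ⟨_, rfl⟩
  have hanti : X * Z = -(Z * X) := by
    have h1 : Z * X + X * Z = 0 := by
      have h2 : Z * X + X * Z = (Y * X + X * Y) - (2 * c) • (1 : Matrix (Fin d) (Fin d) ℝ) := by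
        rw [hZ, sub_mul, mul_sub, Matrix.smul_mul, Matrix.mul_smul, hXi, hiX, two_mul, add_smul]
        abel
      rw [h2, h, hc, mul_assoc, sub_self]
    exact eq_neg_of_add_eq_zero_right h1
  have hZs : Zᴴ = Z := by
    have hXh : X⁻¹ᴴ = X⁻¹ := hX.isHermitian.inv.eq
    have hYh : Yᴴ = Y := by
      rw [Matrix.conjTranspose_eq_transpose_of_trivial]; exact hY
    rw [hZ, Matrix.conjTranspose_sub, Matrix.conjTranspose_smul, hXh, hYh, star_trivial]
  have hps : (Zᴴ * X * Z).PosSemidef := hX.posSemidef.conjTranspose_mul_mul_same Z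
  rw [hZs] at hps
  have ht : (Z * X * Z).trace = 0 := by
    have h1 : (Z * X * Z).trace = -(Z * X * Z).trace := by
      conv_lhs => rw [mul_assoc, hanti, mul_neg, Matrix.trace_neg, Matrix.trace_mul_comm]
    linarith
  have h0 : Z * X * Z = 0 := hps.trace_eq_zero_iff.mp ht
  have h3 : X * (Z * Z) = 0 := by
    rw [← mul_assoc, hanti, neg_mul, h0, neg_zero]
  have h4 : Zᴴ * Z = 0 := by
    rw [hZs, ← one_mul (Z * Z), ← hiX, mul_assoc, h3, mul_zero]
  have hZ0 : Z = 0 := Matrix.conjTranspose_mul_self_eq_zero.mp h4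
  have hYc : Y = c • X⁻¹ := by
    rw [hZ] at hZ0; exact sub_eq_zero.mp hZ0
  have htr : Y.trace = c * (X⁻¹).trace := by
    conv_lhs => rw [hYc, Matrix.trace_smul, smul_eq_mul]
  have ht0 : Y.trace = 0 := by
    have h5 : Y.trace * (a * (X⁻¹).trace - 1) = 0 := by
      rw [hc] at htr; linarith
    exact (mul_eq_zero.mp h5).resolve_right (sub_ne_zero.mpr ha')
  rw [hYc, hc, ht0, mul_zero, zero_smul]
end

section
/- Let d ≥ 1, let X be a d×d real symmetric positive definite matrix, let a ≥ 0 with a·Tr[X⁻¹] ≠ 1, and let Y, Z be real symmetric d×d matrices such that ZX + XZ − 2a·Tr[Z]·I_d = Y (i.e., Z = L_{X,a}^{-1}(Y)). Then Tr[Z] = Tr[X⁻¹Y] / (2(1 − a·Tr[X⁻¹])). -/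
open Matrix

/-- If `Z` is the (unique) symmetric solution of
`ZX + XZ − 2a·Tr[Z]·I_d = Y` with `X` symmetric positive definite, `a ≥ 0` and
`a·Tr[X⁻¹] ≠ 1`, then `Tr[Z] = Tr[X⁻¹Y] / (2(1 − a·Tr[X⁻¹]))`. -/
theorem stmt_1 (d : ℕ) (hd : 1 ≤ d) (X : Matrix (Fin d) (Fin d) ℝ)
    (hX : X.PosDef) (a : ℝ) (ha : 0 ≤ a)
    (ha' : a * Matrix.trace X⁻¹ ≠ 1)
    (Y Z : Matrix (Fin d) (Fin d) ℝ) (hY : Y.IsSymm) (hZ : Z.IsSymm)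
    (heq : Z * X + X * Z - (2 * a * Matrix.trace Z) • (1 : Matrix (Fin d) (Fin d) ℝ) = Y) :
    Matrix.trace Z = Matrix.trace (X⁻¹ * Y) / (2 * (1 - a * Matrix.trace X⁻¹)) := by
  have hdet : IsUnit X.det := (Matrix.isUnit_iff_isUnit_det X).mp hX.isUnit
  have h1 : X * X⁻¹ = 1 := Matrix.mul_nonsing_inv X hdet
  have h2 : X⁻¹ * X = 1 := Matrix.nonsing_inv_mul X hdet
  have t1 : Matrix.trace (X⁻¹ * (Z * X)) = Matrix.trace Z := by
    rw [Matrix.trace_mul_comm, Matrix.mul_assoc, h1, Matrix.mul_one]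
  have t2 : Matrix.trace (X⁻¹ * (X * Z)) = Matrix.trace Z := by
    rw [← Matrix.mul_assoc, h2, Matrix.one_mul]
  have hne : 2 * (1 - a * Matrix.trace X⁻¹) ≠ 0 :=
    mul_ne_zero two_ne_zero (sub_ne_zero.mpr (Ne.symm ha'))
  rw [eq_div_iff hne, ← heq, Matrix.mul_sub, Matrix.mul_add, Matrix.trace_sub,
    Matrix.trace_add, t1, t2, Matrix.mul_smul, Matrix.mul_one, Matrix.trace_smul, smul_eq_mul]
  ring
end

section
/- Let d ≥ 1, let X be a d×d real symmetric positive definite matrix, and let a be a real number with 0 ≤ a < 1/Tr[X⁻¹]. Then the linear map L_{X,a}(Y) = YX + XY − 2a·Tr[Y]·I_d on S_d is self-adjoint with respect to the trace inner product, i.e., Tr[L_{X,a}(Y)·Z] = Tr[Y·L_{X,a}(Z)] for all symmetric Y, Z, and positive definite: Tr[L_{X,a}(Y)·Y] > 0 for every nonzero symmetric Y. -/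
open Matrix

theorem trace_conj_eq {d : ℕ} (X Y : Matrix (Fin d) (Fin d) ℝ) :
    Matrix.trace (Y * X * Yᵀ) = ∑ i, (Y i) ⬝ᵥ (X *ᵥ (Y i)) := by
  rw [Matrix.mul_assoc]
  rfl

theorem trace_conj_pos {d : ℕ} (X Y : Matrix (Fin d) (Fin d) ℝ) (hX : X.PosDef) (hY : Y ≠ 0) :
    0 < Matrix.trace (Y * X * Yᵀ) := by
  rw [trace_conj_eq]
  have hnn : ∀ v : Fin d → ℝ, 0 ≤ v ⬝ᵥ (X *ᵥ v) := fun v => by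
    simpa using hX.posSemidef.dotProduct_mulVec_nonneg v
  obtain ⟨i, hi⟩ : ∃ i, Y i ≠ 0 := by
    by_contra! h
    exact hY (funext h)
  refine Finset.sum_pos' (fun i _ => hnn _) ⟨i, Finset.mem_univ _, ?_⟩
  simpa using hX.dotProduct_mulVec_pos hi

theorem trace_conj_nonneg {d : ℕ} (X Y : Matrix (Fin d) (Fin d) ℝ) (hX : X.PosDef) :
    0 ≤ Matrix.trace (Y * X * Yᵀ) := by
  by_cases hY : Y = 0
  · simp [hY]
  · exact (trace_conj_pos X Y hX hY).le

/-- For `X` symmetric positive definite and `0 ≤ a < 1/Tr[X⁻¹]`,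
the map `L_{X,a}(Y) = YX + XY − 2a·Tr[Y]·I_d` on symmetric matrices is
self-adjoint for the trace inner product and positive definite. -/
theorem stmt_4 (d : ℕ) (hd : 1 ≤ d) (X : Matrix (Fin d) (Fin d) ℝ)
    (hX : X.PosDef) (a : ℝ) (ha0 : 0 ≤ a) (ha : a < 1 / Matrix.trace X⁻¹) :
    (∀ Y Z : Matrix (Fin d) (Fin d) ℝ, Y.IsSymm → Z.IsSymm →
      Matrix.trace ((Y * X + X * Y
        - (2 * a * Matrix.trace Y) • (1 : Matrix (Fin d) (Fin d) ℝ)) * Z)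
      = Matrix.trace (Y * (Z * X + X * Z
        - (2 * a * Matrix.trace Z) • (1 : Matrix (Fin d) (Fin d) ℝ)))) ∧
    (∀ Y : Matrix (Fin d) (Fin d) ℝ, Y.IsSymm → Y ≠ 0 →
      0 < Matrix.trace ((Y * X + X * Y
        - (2 * a * Matrix.trace Y) • (1 : Matrix (Fin d) (Fin d) ℝ)) * Y)) := by
  constructor
  · intro Y Z _ _
    simp only [Matrix.sub_mul, Matrix.add_mul, Matrix.mul_sub, Matrix.mul_add, Matrix.trace_sub,
      Matrix.trace_add, Matrix.smul_mul, Matrix.mul_smul, Matrix.one_mul, Matrix.mul_one,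
      Matrix.trace_smul, smul_eq_mul]
    have h1 : Matrix.trace (X * Y * Z) = Matrix.trace (Y * (Z * X)) := by
      rw [Matrix.mul_assoc, Matrix.trace_mul_comm, Matrix.mul_assoc]
    rw [h1, Matrix.mul_assoc Y X Z]
    ring
  · intro Y hY hne
    have hu : IsUnit X.det := (Matrix.isUnit_iff_isUnit_det _).1 hX.isUnit
    haveI : Nonempty (Fin d) := ⟨⟨0, hd⟩⟩
    have hT : 0 < Matrix.trace X⁻¹ := hX.inv.trace_pos
    have hXi : (X⁻¹)ᵀ = X⁻¹ := by
      have := hX.inv.isHermitian.eq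
      rwa [Matrix.conjTranspose_eq_transpose_of_trivial] at this
    have hp := trace_conj_pos X Y hX hne
    rw [hY.eq] at hp
    have hq := trace_conj_nonneg X (Y - (Y.trace / Matrix.trace X⁻¹) • X⁻¹) hX
    rw [Matrix.transpose_sub, Matrix.transpose_smul, hY.eq, hXi] at hq
    have h1 : Matrix.trace (X * Y * Y) = Matrix.trace (Y * X * Y) := by
      rw [Matrix.mul_assoc, Matrix.trace_mul_comm, Matrix.mul_assoc, Matrix.mul_assoc,
        Matrix.trace_mul_comm Y (X * Y), Matrix.mul_assoc, ← Matrix.mul_assoc,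
        Matrix.trace_mul_comm, ← Matrix.mul_assoc, Matrix.mul_assoc]
    simp only [Matrix.sub_mul, Matrix.add_mul, Matrix.mul_sub, Matrix.trace_sub,
      Matrix.trace_add, Matrix.smul_mul, Matrix.mul_smul, Matrix.one_mul,
      Matrix.trace_smul, smul_eq_mul, Matrix.nonsing_inv_mul X hu, Matrix.mul_assoc Y X X⁻¹,
      Matrix.mul_nonsing_inv X hu, Matrix.mul_one] at hq ⊢
    rw [h1]
    set t := Y.trace
    set T := Matrix.trace X⁻¹
    set p := Matrix.trace (Y * X * Y)
    have hq' : t ^ 2 / T ≤ p := by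
      have e : t / T * (t / T * T) = t ^ 2 / T := by field_simp
      have e2 : t / T * t = t ^ 2 / T := by ring
      linarith
    by_cases ht : t = 0
    · rw [ht]; linarith
    · have : a * t ^ 2 < 1 / T * t ^ 2 := mul_lt_mul_of_pos_right ha (by positivity)
      have e2 : 1 / T * t ^ 2 = t ^ 2 / T := by ring
      nlinarith
end

section
/- Let d ≥ 1 and let X be a d×d real symmetric positive definite matrix. Define L̄_X : M_d → M_d on the space of all real d×d matrices by L̄_X(Y) = L_X^{-1}(YX + XYᵀ)·X, where L_X^{-1}(YX + XYᵀ) is the unique symmetric matrix W with WX + XW = YX + XYᵀ. Then L̄_X is self-adjoint for the trace inner product on M_d, i.e., Tr[L̄_X(Y)ᵀ·Z] = Tr[Yᵀ·L̄_X(Z)] for all Y, Z ∈ M_d, and it is positive: Tr[L̄_X(Y)ᵀ·Y] ≥ 0 for all Y ∈ M_d. -/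
open Matrix

theorem key_aux {d : ℕ} (X W V Z : Matrix (Fin d) (Fin d) ℝ) (hX : Xᵀ = X) (hW : Wᵀ = W)
    (h : V * X + X * V = Z * X + X * Zᵀ) :
    2 * Matrix.trace ((W * X)ᵀ * Z) = Matrix.trace (W * V * X) + Matrix.trace (W * X * V) := by
  have h1 : Matrix.trace ((W * X)ᵀ * Z) = Matrix.trace (W * (Z * X)) := by
    rw [Matrix.transpose_mul, hX, hW, Matrix.mul_assoc, Matrix.trace_mul_comm, Matrix.mul_assoc]
  have h2 : Matrix.trace ((W * X)ᵀ * Z) = Matrix.trace (W * (X * Zᵀ)) := by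
    rw [← Matrix.trace_transpose, Matrix.transpose_mul, Matrix.transpose_transpose,
      Matrix.trace_mul_comm, Matrix.mul_assoc]
  have h3 := congrArg (fun M => Matrix.trace (W * M)) h
  simp only [Matrix.mul_add, Matrix.trace_add] at h3
  rw [Matrix.mul_assoc W V X, Matrix.mul_assoc W X V]
  linarith

/-- For `X` symmetric positive definite, the map
`L̄_X(Y) = L_X⁻¹(YX + XYᵀ)·X` on all real `d × d` matrices (where
`W = L_X⁻¹(YX + XYᵀ)` is the unique symmetric matrix with `WX + XW = YX + XYᵀ`)
is self-adjoint for the trace inner product `⟨A, B⟩ = Tr[AᵀB]`, and positive: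
`Tr[L̄_X(Y)ᵀ·Y] ≥ 0`. -/
theorem stmt_5 (d : ℕ) (hd : 1 ≤ d) (X : Matrix (Fin d) (Fin d) ℝ)
    (hX : X.PosDef) :
    ∀ Y Z WY WZ : Matrix (Fin d) (Fin d) ℝ,
      WY.IsSymm → WZ.IsSymm →
      WY * X + X * WY = Y * X + X * Yᵀ →
      WZ * X + X * WZ = Z * X + X * Zᵀ →
      Matrix.trace ((WY * X)ᵀ * Z) = Matrix.trace (Yᵀ * (WZ * X)) ∧
      0 ≤ Matrix.trace ((WY * X)ᵀ * Y) := by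
  intro Y Z WY WZ hY hZ eY eZ
  have hXs : Xᵀ = X := by simpa [Matrix.conjTranspose_eq_transpose_of_trivial] using hX.1.eq
  constructor
  · have a := key_aux X WY WZ Z hXs hY.eq eZ
    have b := key_aux X WZ WY Y hXs hZ.eq eY
    have c : Matrix.trace (Yᵀ * (WZ * X)) = Matrix.trace ((WZ * X)ᵀ * Y) := by
      rw [← Matrix.trace_transpose, Matrix.transpose_mul, Matrix.transpose_transpose]
    have e1 : Matrix.trace (WZ * WY * X) = Matrix.trace (WY * X * WZ) := by
      rw [Matrix.mul_assoc, Matrix.trace_mul_comm]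
    have e2 : Matrix.trace (WZ * X * WY) = Matrix.trace (WY * WZ * X) := by
      rw [Matrix.trace_mul_comm, Matrix.mul_assoc]
    linarith
  · have a := key_aux X WY WY Y hXs hY.eq eY
    have e1 : Matrix.trace (WY * WY * X) = Matrix.trace (WY * X * WY) := by
      rw [Matrix.mul_assoc, Matrix.trace_mul_comm]
    have p : 0 ≤ Matrix.trace (WY * X * WY) := by
      have q := (hX.posSemidef.mul_mul_conjTranspose_same WY).trace_nonneg
      rwa [Matrix.conjTranspose_eq_transpose_of_trivial, hY.eq] at q
    linarith
end

section
/- Let d ≥ 1, let X be a d×d real symmetric positive definite matrix and let a be a real number with a < 1/Tr[X⁻¹]. For Y ∈ M_d let W = L_X^{-1}(YX + XYᵀ) be the unique symmetric matrix with WX + XW = YX + XYᵀ, and define L̄_{X,a}(Y) = W·X − a·Tr[Y]·I_d. Then for all Y ∈ M_d one has the identity Tr[L̄_{X,a}(Y)ᵀ·Y] = (1/2)·Tr[L_{X,a}(W)·W], where L_{X,a}(W) = WX + XW − 2a·Tr[W]·I_d; moreover there exists a constant c_{X,a} > 0 (depending only on X and a) such that Tr[L̄_{X,a}(Y)ᵀ·Y]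 ≥ c_{X,a}·Tr[W²] for all Y ∈ M_d. -/
open Matrix

theorem aux_cs (d : ℕ) (X : Matrix (Fin d) (Fin d) ℝ) (hX : X.PosDef) (w v : Fin d → ℝ) :
    (w ⬝ᵥ v) ^ 2 ≤ (w ⬝ᵥ (X *ᵥ w)) * (v ⬝ᵥ (X⁻¹ *ᵥ v)) := by
  have hu : IsUnit X.det := hX.det_pos.ne'.isUnit
  have hT : Xᵀ = X := by simpa using hX.isHermitian.eq
  have h1 : X *ᵥ (X⁻¹ *ᵥ v) = v := by
    rw [Matrix.mulVec_mulVec, Matrix.mul_nonsing_inv _ hu, Matrix.one_mulVec]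
  have h2 : (X⁻¹ *ᵥ v) ⬝ᵥ (X *ᵥ w) = w ⬝ᵥ v := by
    rw [Matrix.dotProduct_mulVec, ← Matrix.mulVec_transpose, hT, h1, dotProduct_comm]
  have key : ∀ s : ℝ, 0 ≤ (v ⬝ᵥ (X⁻¹ *ᵥ v)) * (s * s) + (-2 * (w ⬝ᵥ v)) * s
      + (w ⬝ᵥ (X *ᵥ w)) := by
    intro s
    have h := hX.posSemidef.dotProduct_mulVec_nonneg (w - s • (X⁻¹ *ᵥ v))
    simp only [star_trivial, Matrix.mulVec_sub, Matrix.mulVec_smul, h1, sub_dotProduct,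
      dotProduct_sub, smul_dotProduct, dotProduct_smul, h2, smul_eq_mul] at h
    rw [dotProduct_comm (X⁻¹ *ᵥ v) v] at h
    linarith
  have := discrim_le_zero key
  unfold discrim at this
  linarith

theorem aux_q (d : ℕ) (X : Matrix (Fin d) (Fin d) ℝ) (hX : X.PosDef)
    (W : Matrix (Fin d) (Fin d) ℝ) (hW : W.IsSymm) :
    trace (W * W) ≤ trace X⁻¹ * trace (W * X * W) := by
  have e1 : trace (W * W) = ∑ j, ∑ i, (W.col j ⬝ᵥ Pi.single i 1) ^ 2 := by
    simp only [Matrix.trace, Matrix.diag, Matrix.mul_apply, dotProduct_single, Matrix.col_apply]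
    refine Finset.sum_congr rfl fun j _ => Finset.sum_congr rfl fun i _ => ?_
    rw [hW.apply i j]; ring
  have e2 : trace X⁻¹ * trace (W * X * W) = ∑ j, ∑ i, (W.col j ⬝ᵥ (X *ᵥ W.col j)) *
      ((Pi.single i 1 : Fin d → ℝ) ⬝ᵥ (X⁻¹ *ᵥ Pi.single i 1)) := by
    have h3 : trace (W * X * W) = ∑ j, W.col j ⬝ᵥ (X *ᵥ W.col j) := by
      rw [Matrix.mul_assoc]
      simp only [Matrix.trace, Matrix.diag]
      refine Finset.sum_congr rfl fun j _ => ?_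
      simp only [Matrix.mul_apply, dotProduct, Matrix.mulVec, Matrix.col_apply]
      refine Finset.sum_congr rfl fun i _ => ?_
      rw [hW.apply i j]
    simp_rw [← Finset.mul_sum]
    rw [← Finset.sum_mul, ← h3, mul_comm]
    simp [Matrix.trace]
  rw [e1, e2]
  exact Finset.sum_le_sum fun j _ => Finset.sum_le_sum fun i _ => aux_cs d X hX _ _

theorem aux_t (d : ℕ) (X : Matrix (Fin d) (Fin d) ℝ) (hX : X.PosDef)
    (W : Matrix (Fin d) (Fin d) ℝ) (hW : W.IsSymm) :
    (trace W) ^ 2 ≤ trace X⁻¹ * trace (W * X * W) := by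
  have hu : IsUnit X.det := hX.det_pos.ne'.isUnit
  have hi : (X⁻¹)ᵀ = X⁻¹ := by simpa using hX.inv.isHermitian.eq
  have key : ∀ s : ℝ, 0 ≤ (trace X⁻¹) * (s * s) + (-2 * trace W) * s
      + trace (W * X * W) := by
    intro s
    have h := (hX.posSemidef.conjTranspose_mul_mul_same (W - s • X⁻¹)).trace_nonneg
    simp only [conjTranspose_eq_transpose_of_trivial, transpose_sub, transpose_smul, hi, hW.eq,
      Matrix.sub_mul, Matrix.mul_sub, Matrix.smul_mul, Matrix.mul_smul, trace_sub, trace_smul,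
      Matrix.nonsing_inv_mul _ hu, Matrix.mul_assoc, Matrix.mul_nonsing_inv _ hu,
      Matrix.one_mul, Matrix.mul_one, smul_eq_mul] at h
    rw [Matrix.mul_assoc]
    linarith
  have := discrim_le_zero key
  unfold discrim at this
  linarith

theorem aux_tr (d : ℕ) (X : Matrix (Fin d) (Fin d) ℝ) (hX : X.PosDef)
    (Y W : Matrix (Fin d) (Fin d) ℝ) (h : W * X + X * W = Y * X + X * Yᵀ) :
    trace Y = trace W := by
  have hu : IsUnit X.det := hX.det_pos.ne'.isUnit
  have h1 := congrArg (fun M => trace (M * X⁻¹)) h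
  have e : ∀ A B : Matrix (Fin d) (Fin d) ℝ,
      trace ((A * X + X * B) * X⁻¹) = trace A + trace B := by
    intro A B
    rw [Matrix.add_mul, trace_add, Matrix.mul_assoc, Matrix.mul_nonsing_inv _ hu, Matrix.mul_one,
      trace_mul_comm (X * B), ← Matrix.mul_assoc, Matrix.nonsing_inv_mul _ hu, Matrix.one_mul]
  simp only [e, trace_transpose] at h1
  linarith

theorem aux_id (d : ℕ) (X : Matrix (Fin d) (Fin d) ℝ) (hX : X.PosDef) (a : ℝ)
    (Y W : Matrix (Fin d) (Fin d) ℝ) (hW : W.IsSymm) (h : W * X + X * W = Y * X + X * Yᵀ) :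
    trace ((W * X - (a * trace Y) • (1 : Matrix (Fin d) (Fin d) ℝ))ᵀ * Y)
      = trace (W * X * W) - a * trace W ^ 2 := by
  have hT : Xᵀ = X := by simpa using hX.isHermitian.eq
  have h1 := congrArg (fun M => trace (M * W)) h
  simp only [Matrix.add_mul, trace_add] at h1
  have h2 : trace (X * W * W) = trace (W * X * W) := by
    rw [trace_mul_comm, Matrix.mul_assoc]
  have h3 : trace (Y * X * W) = trace (X * W * Y) := by
    rw [Matrix.mul_assoc, trace_mul_comm]
  have h4 : trace (X * Yᵀ * W) = trace (X * W * Y) := by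
    rw [← trace_transpose (X * Yᵀ * W)]
    simp only [transpose_mul, transpose_transpose, hT, hW.eq]
    rw [← Matrix.mul_assoc, trace_mul_comm, ← Matrix.mul_assoc]
  simp only [transpose_sub, transpose_mul, transpose_smul, transpose_one, hT, hW.eq,
    Matrix.sub_mul, trace_sub, Matrix.smul_mul, Matrix.one_mul, trace_smul, smul_eq_mul,
    aux_tr d X hX Y W h]
  linarith

/-- For `X` symmetric positive definite and `a < 1/Tr[X⁻¹]`,
with `W = L_X⁻¹(YX + XYᵀ)` the unique symmetric matrix satisfying
`WX + XW = YX + XYᵀ`, and `L̄_{X,a}(Y) = W·X − a·Tr[Y]·I_d`, one has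
`Tr[L̄_{X,a}(Y)ᵀ·Y] = (1/2)·Tr[L_{X,a}(W)·W]` with
`L_{X,a}(W) = WX + XW − 2a·Tr[W]·I_d`; moreover there is a constant
`c_{X,a} > 0` (depending only on `X` and `a`) with
`Tr[L̄_{X,a}(Y)ᵀ·Y] ≥ c_{X,a}·Tr[W²]` for all `Y`. -/
theorem stmt_6 (d : ℕ) (hd : 1 ≤ d) (X : Matrix (Fin d) (Fin d) ℝ)
    (hX : X.PosDef) (a : ℝ) (ha : a < 1 / Matrix.trace X⁻¹) :
    (∀ Y W : Matrix (Fin d) (Fin d) ℝ, W.IsSymm →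
      W * X + X * W = Y * X + X * Yᵀ →
      Matrix.trace ((W * X - (a * Matrix.trace Y) • (1 : Matrix (Fin d) (Fin d) ℝ))ᵀ * Y)
        = (1 / 2) * Matrix.trace ((W * X + X * W
            - (2 * a * Matrix.trace W) • (1 : Matrix (Fin d) (Fin d) ℝ)) * W)) ∧
    (∃ c : ℝ, 0 < c ∧
      ∀ Y W : Matrix (Fin d) (Fin d) ℝ, W.IsSymm →
        W * X + X * W = Y * X + X * Yᵀ →
        c * Matrix.trace (W * W) ≤
          Matrix.trace ((W * X
            - (a * Matrix.trace Y) • (1 : Matrix (Fin d) (Fin d) ℝ))ᵀ * Y)) := by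
  haveI : Nonempty (Fin d) := ⟨⟨0, hd⟩⟩
  have ht : 0 < trace X⁻¹ := hX.inv.trace_pos
  have hat : a * trace X⁻¹ < 1 := (lt_div_iff₀ ht).1 ha
  refine ⟨fun Y W hW h => ?_, min 1 (1 - a * trace X⁻¹) / trace X⁻¹,
    div_pos (lt_min one_pos (by linarith)) ht, fun Y W hW h => ?_⟩
  · rw [aux_id d X hX a Y W hW h]
    have h2 : trace (X * W * W) = trace (W * X * W) := by
      rw [trace_mul_comm, Matrix.mul_assoc]
    simp only [Matrix.sub_mul, Matrix.add_mul, trace_sub, trace_add, Matrix.smul_mul,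
      Matrix.one_mul, trace_smul, smul_eq_mul, h2]
    ring
  · rw [aux_id d X hX a Y W hW h]
    have hq := aux_q d X hX W hW
    have hs := aux_t d X hX W hW
    set t := trace X⁻¹
    set p := trace (W * X * W)
    set q := trace (W * W)
    have hp : 0 ≤ p := by
      by_contra hn
      nlinarith [sq_nonneg (trace W)]
    have hm : 0 < min 1 (1 - a * t) := lt_min one_pos (by linarith)
    have hc : min 1 (1 - a * t) / t * q ≤ min 1 (1 - a * t) * p := by
      rw [div_mul_eq_mul_div, div_le_iff₀ ht]
      nlinarith
    refine hc.trans ?_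
    rcases le_total a 0 with h0 | h0
    · have := mul_le_mul_of_nonneg_right (min_le_left 1 (1 - a * t)) hp
      nlinarith [mul_nonneg (neg_nonneg.2 h0) (sq_nonneg (trace W))]
    · have := mul_le_mul_of_nonneg_right (min_le_right 1 (1 - a * t)) hp
      nlinarith [mul_le_mul_of_nonneg_left hs h0]
end

section
/- Let d ≥ 1, let X be a d×d real symmetric positive definite matrix and let b be any real d×d matrix. If W is the unique symmetric matrix with WX + XW = bX + Xbᵀ (i.e., W = L_X^{-1}(bX + Xbᵀ)), then Tr[W] = Tr[b]. -/
open Matrix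

/-- If `X` is symmetric positive definite, `b` is any real
`d × d` matrix, and `W` is the unique symmetric matrix with
`WX + XW = bX + Xbᵀ`, then `Tr[W] = Tr[b]`. -/
theorem stmt_7 (d : ℕ) (hd : 1 ≤ d) (X : Matrix (Fin d) (Fin d) ℝ)
    (hX : X.PosDef) (b W : Matrix (Fin d) (Fin d) ℝ) (hW : W.IsSymm)
    (heq : W * X + X * W = b * X + X * bᵀ) :
    Matrix.trace W = Matrix.trace b := by
  have hu : IsUnit X.det := hX.det_pos.ne'.isUnit
  have h := congrArg (fun M => Matrix.trace (M * X⁻¹)) heq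
  have key : ∀ A : Matrix (Fin d) (Fin d) ℝ,
      Matrix.trace (X * A * X⁻¹) = Matrix.trace A := by
    intro A
    rw [Matrix.trace_mul_comm, ← Matrix.mul_assoc, Matrix.nonsing_inv_mul _ hu, Matrix.one_mul]
  simp only [Matrix.add_mul, Matrix.trace_add, key, Matrix.mul_nonsing_inv_cancel_right _ _ hu,
    Matrix.trace_transpose] at h
  linarith
end

section
/- Let d ≥ 1, let X be a d×d real symmetric positive definite matrix, let b be any real d×d matrix and let α be a real number. Let W be the unique symmetric matrix with WX + XW = bX + Xbᵀ. Then |α·Tr[b]| ≤ Tr[W²·X] + (α²/4)·Tr[X⁻¹], and consequently |α·Tr[b]| ≤ (1/2)·Tr[W·(bX + Xbᵀ)] + (α²/4)·Tr[X⁻¹]. -/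
open Matrix

/-- For `X` symmetric positive definite, `b` any real matrix,
`α ∈ ℝ`, and `W` the unique symmetric matrix with `WX + XW = bX + Xbᵀ`, one has
`|α·Tr[b]| ≤ Tr[W²·X] + (α²/4)·Tr[X⁻¹]`, and consequently
`|α·Tr[b]| ≤ (1/2)·Tr[W·(bX + Xbᵀ)] + (α²/4)·Tr[X⁻¹]`. -/
theorem stmt_9 (d : ℕ) (hd : 1 ≤ d) (X : Matrix (Fin d) (Fin d) ℝ)
    (hX : X.PosDef) (b : Matrix (Fin d) (Fin d) ℝ) (α : ℝ)
    (W : Matrix (Fin d) (Fin d) ℝ) (hW : W.IsSymm)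
    (heq : W * X + X * W = b * X + X * bᵀ) :
    |α * Matrix.trace b| ≤ Matrix.trace (W * W * X) + α ^ 2 / 4 * Matrix.trace X⁻¹ ∧
    |α * Matrix.trace b| ≤
      (1 / 2) * Matrix.trace (W * (b * X + X * bᵀ)) + α ^ 2 / 4 * Matrix.trace X⁻¹ := by
  have hu : IsUnit X.det := (Matrix.isUnit_iff_isUnit_det X).mp hX.isUnit
  have h1 : X * X⁻¹ = 1 := Matrix.mul_nonsing_inv X hu
  have h2 : X⁻¹ * X = 1 := Matrix.nonsing_inv_mul X hu
  have hXs : Xᵀ = X := by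
    have := hX.isHermitian
    rwa [Matrix.IsHermitian, Matrix.conjTranspose_eq_transpose_of_trivial] at this
  have hXi : (X⁻¹)ᵀ = X⁻¹ := by rw [Matrix.transpose_nonsing_inv, hXs]
  have hWt : Wᵀ = W := hW
  have cyc : ∀ A : Matrix (Fin d) (Fin d) ℝ, trace (X * A * X⁻¹) = trace A := by
    intro A
    rw [Matrix.trace_mul_comm, ← Matrix.mul_assoc, h2, Matrix.one_mul]
  have cyc2 : ∀ A : Matrix (Fin d) (Fin d) ℝ, trace (A * X * X⁻¹) = trace A := by
    intro A
    rw [Matrix.mul_assoc, h1, Matrix.mul_one]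
  have htr : trace W = trace b := by
    have h := congrArg (fun M => trace (M * X⁻¹)) heq
    simp only [Matrix.add_mul, Matrix.trace_add, cyc, cyc2, Matrix.trace_transpose] at h
    linarith
  have hWXW : trace (W * X * W) = trace (W * W * X) := by
    rw [Matrix.trace_mul_comm, Matrix.mul_assoc]
  have key : ∀ c : ℝ, 0 ≤ trace (W * W * X) - 2 * c * trace W + c ^ 2 * trace X⁻¹ := by
    intro c
    have h := (hX.posSemidef.mul_mul_conjTranspose_same (W - c • X⁻¹)).trace_nonneg
    have e : (W - c • X⁻¹) * X * (W - c • X⁻¹)ᴴ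
        = W * X * W - c • W - c • W + c ^ 2 • X⁻¹ := by
      rw [Matrix.conjTranspose_eq_transpose_of_trivial, Matrix.transpose_sub,
        Matrix.transpose_smul, hXi, hWt, Matrix.sub_mul, Matrix.smul_mul, h2,
        Matrix.sub_mul, Matrix.mul_sub, Matrix.mul_sub, Matrix.mul_smul, Matrix.mul_smul,
        Matrix.smul_mul, Matrix.smul_mul, Matrix.one_mul, Matrix.one_mul, Matrix.mul_assoc W X X⁻¹,
        h1, Matrix.mul_one, smul_smul, ← pow_two]
      abel
    rw [e] at h
    simp only [Matrix.trace_add, Matrix.trace_sub, Matrix.trace_smul, smul_eq_mul, hWXW] at h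
    linarith
  have main : |α * Matrix.trace b| ≤
      Matrix.trace (W * W * X) + α ^ 2 / 4 * Matrix.trace X⁻¹ := by
    rw [← htr, abs_le]
    have k1 := key (α / 2)
    have k2 := key (-(α / 2))
    constructor <;> nlinarith
  have e2 : (1 / 2) * Matrix.trace (W * (b * X + X * bᵀ)) = trace (W * W * X) := by
    rw [← heq, Matrix.mul_add, Matrix.trace_add, ← Matrix.mul_assoc, ← Matrix.mul_assoc, hWXW]
    ring
  exact ⟨main, by rw [e2]; exact main⟩
end

section
/- Let d ≥ 1, let X be a d×d real symmetric positive definite matrix and let b be a d×d real antisymmetric matrix (bᵀ = −b). Let Γ be the unique symmetric matrix with ΓX + XΓ = (1/2)(bX − Xb). Then Tr[Γ] = 0 and Tr[Γ·(Xb − bX)] = −4·Tr[Γ²·X]. -/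
open Matrix

/-- For `X` symmetric positive definite and `b` antisymmetric
(`bᵀ = −b`), if `Γ` is the unique symmetric matrix with
`ΓX + XΓ = (1/2)(bX − Xb)`, then `Tr[Γ] = 0` and
`Tr[Γ·(Xb − bX)] = −4·Tr[Γ²·X]`. -/
theorem stmt_10 (d : ℕ) (hd : 1 ≤ d) (X : Matrix (Fin d) (Fin d) ℝ)
    (hX : X.PosDef) (b : Matrix (Fin d) (Fin d) ℝ) (hb : bᵀ = -b)
    (Γ : Matrix (Fin d) (Fin d) ℝ) (hΓ : Γ.IsSymm)
    (heq : Γ * X + X * Γ = (1 / 2 : ℝ) • (b * X - X * b)) :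
    Matrix.trace Γ = 0 ∧
    Matrix.trace (Γ * (X * b - b * X)) = -4 * Matrix.trace (Γ * Γ * X) := by
  have hu : IsUnit X.det := (Matrix.isUnit_iff_isUnit_det X).1 hX.isUnit
  have h1 : X * X⁻¹ = 1 := Matrix.mul_nonsing_inv X hu
  have h2 : X⁻¹ * X = 1 := Matrix.nonsing_inv_mul X hu
  constructor
  · have h := congrArg (fun M => Matrix.trace (M * X⁻¹)) heq
    simp only [add_mul, sub_mul, smul_mul_assoc, Matrix.trace_add, Matrix.trace_sub,
      Matrix.trace_smul, Matrix.mul_assoc, h1, mul_one] at h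
    rw [Matrix.trace_mul_comm X (Γ * X⁻¹), Matrix.trace_mul_comm X (b * X⁻¹),
      Matrix.mul_assoc, Matrix.mul_assoc, h2, mul_one, mul_one, sub_self, smul_zero] at h
    linarith
  · have h : X * b - b * X = (-2 : ℝ) • (Γ * X + X * Γ) := by
      rw [heq, smul_smul, ← neg_sub (b * X) (X * b)]
      norm_num
    rw [h, mul_smul_comm, Matrix.trace_smul, mul_add, Matrix.trace_add,
      ← Matrix.mul_assoc, ← Matrix.mul_assoc, Matrix.trace_mul_comm (Γ * X) Γ,
      ← Matrix.mul_assoc, smul_eq_mul]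
    ring
end

section
/- Let d ≥ 1, let b̃ be a d×d real symmetric matrix and δ̃ a d×d real symmetric positive semidefinite matrix. Let T > 0 and let ξ : [0, T] → S_d be a differentiable matrix-valued function satisfying the matrix Riccati differential equation ξ'(t) + 2·ξ(t)² = b̃·ξ(t) + ξ(t)·b̃ + δ̃ for all t ∈ [0, T], with ξ(0) positive semidefinite. Then ξ(t) is positive semidefinite for every t ∈ [0, T]. -/
open Matrix Set

attribute [local instance] Matrix.normedAddCommGroup Matrix.normedSpace

set_option maxHeartbeats 1600000 in
/-- Let `b̃` be symmetric and `δ̃` positive semidefinite, let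
`T > 0`, and let `ξ : [0, T] → S_d` be differentiable (in the sense of
`HasDerivWithinAt` on `[0, T]`, with derivative `ξ'`) and satisfy the matrix
Riccati equation `ξ' + 2ξ² = b̃ξ + ξb̃ + δ̃` on `[0, T]`, with `ξ(0)` positive
semidefinite. Then `ξ(t)` is positive semidefinite for every `t ∈ [0, T]`. -/
theorem stmt_19 (d : ℕ) (hd : 1 ≤ d)
    (btil dtil : Matrix (Fin d) (Fin d) ℝ)
    (hb : btil.IsSymm) (hdel : dtil.PosSemidef)
    (T : ℝ) (hT : 0 < T)
    (ξ ξ' : ℝ → Matrix (Fin d) (Fin d) ℝ)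
    (hsymm : ∀ t ∈ Icc (0 : ℝ) T, (ξ t).IsSymm)
    (hderiv : ∀ t ∈ Icc (0 : ℝ) T, HasDerivWithinAt ξ (ξ' t) (Icc (0 : ℝ) T) t)
    (hric : ∀ t ∈ Icc (0 : ℝ) T,
      ξ' t + (2 : ℝ) • (ξ t * ξ t) = btil * ξ t + ξ t * btil + dtil)
    (h0 : (ξ 0).PosSemidef) :
    ∀ t ∈ Icc (0 : ℝ) T, (ξ t).PosSemidef := by
  have hcont : ContinuousOn ξ (Icc 0 T) := fun t ht => (hderiv t ht).continuousWithinAt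
  -- bound for the quadratic form of `btil`
  have hSc : IsCompact (Metric.sphere (0 : Fin d → ℝ) 1) := isCompact_sphere 0 1
  have hvv : ∀ v ∈ Metric.sphere (0 : Fin d → ℝ) 1, 1 ≤ v ⬝ᵥ v := by
    intro v hv
    have hn : ‖v‖ = 1 := by simpa using hv
    by_contra hlt
    push Not at hlt
    have : ‖v‖ < 1 := by
      rw [pi_norm_lt_iff one_pos]
      intro i
      have h1 : v i * v i ≤ v ⬝ᵥ v :=
        Finset.single_le_sum (f := fun i => v i * v i) (fun j _ => mul_self_nonneg (v j))
          (Finset.mem_univ i)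
      rw [Real.norm_eq_abs, abs_lt]
      constructor <;> nlinarith
    linarith
  obtain ⟨B, hB0, hB⟩ : ∃ B : ℝ, 0 ≤ B ∧ ∀ v ∈ Metric.sphere (0 : Fin d → ℝ) 1,
      v ⬝ᵥ (btil *ᵥ v) ≤ B * (v ⬝ᵥ v) := by
    have hc : ContinuousOn (fun v : Fin d → ℝ => v ⬝ᵥ (btil *ᵥ v)) (Metric.sphere 0 1) := by
      apply Continuous.continuousOn
      unfold mulVec dotProduct
      fun_prop
    obtain ⟨C, hC⟩ := (hSc.image_of_continuousOn hc).bddAbove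
    refine ⟨max C 0, le_max_right _ _, fun v hv => ?_⟩
    have h1 := hC (mem_image_of_mem _ hv)
    have h2 := hvv v hv
    have h3 := le_max_left C 0
    have h4 := le_max_right C 0
    nlinarith
  set K : ℝ := 3 + 2 * B with hK
  have key : ∀ ε : ℝ, 0 < ε → ε * Real.exp (K * T) ≤ 1 → ∀ t ∈ Icc (0 : ℝ) T,
      ∀ v ∈ Metric.sphere (0 : Fin d → ℝ) 1,
      0 < v ⬝ᵥ (ξ t *ᵥ v) + ε * Real.exp (K * t) * (v ⬝ᵥ v) := by
    intro ε hε hε1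
    by_contra hcon
    push Not at hcon
    obtain ⟨t0, ht0, v0, hv0, hle0⟩ := hcon
    set g : ℝ × (Fin d → ℝ) → ℝ := fun p =>
      p.2 ⬝ᵥ (ξ p.1 *ᵥ p.2) + ε * Real.exp (K * p.1) * (p.2 ⬝ᵥ p.2) with hg
    have hgc : ContinuousOn g (Icc 0 T ×ˢ Metric.sphere 0 1) := by
      have hX : ∀ i j, ContinuousOn (fun p : ℝ × (Fin d → ℝ) => ξ p.1 i j)
          (Icc 0 T ×ˢ Metric.sphere 0 1) := by
        intro i j
        have h1 : ContinuousOn (fun t => ξ t i j) (Icc 0 T) :=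
          continuousOn_pi.1 (continuousOn_pi.1 hcont i) j
        exact h1.comp continuousOn_fst (fun p hp => hp.1)
      have hP : ∀ i, ContinuousOn (fun p : ℝ × (Fin d → ℝ) => p.2 i)
          (Icc 0 T ×ˢ Metric.sphere 0 1) := fun i =>
        ((continuous_apply i).comp continuous_snd).continuousOn
      have hE : ContinuousOn (fun p : ℝ × (Fin d → ℝ) => ε * Real.exp (K * p.1))
          (Icc 0 T ×ˢ Metric.sphere 0 1) :=
        (continuous_const.mul (Real.continuous_exp.comp
          (continuous_const.mul continuous_fst))).continuousOn
      simp only [hg, mulVec, dotProduct]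
      exact (continuousOn_finsetSum _ fun i _ => (hP i).mul
        (continuousOn_finsetSum _ fun j _ => (hX i j).mul (hP j))).add
        (hE.mul (continuousOn_finsetSum _ fun i _ => (hP i).mul (hP i)))
    have hKc : IsCompact (Icc (0 : ℝ) T ×ˢ Metric.sphere (0 : Fin d → ℝ) 1) :=
      isCompact_Icc.prod hSc
    have hSS : IsCompact ((Icc (0 : ℝ) T ×ˢ Metric.sphere (0 : Fin d → ℝ) 1) ∩ g ⁻¹' Iic 0) :=
      hKc.of_isClosed_subset (hgc.preimage_isClosed_of_isClosed hKc.isClosed isClosed_Iic)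
        inter_subset_left
    obtain ⟨⟨t, v⟩, ⟨⟨ht, hv⟩, hgle⟩, hmin⟩ := hSS.exists_isMinOn
      ⟨(t0, v0), ⟨⟨ht0, hv0⟩, hle0⟩⟩ continuousOn_fst
    have hpos : ∀ s ∈ Ico 0 t, ∀ w ∈ Metric.sphere (0 : Fin d → ℝ) 1, 0 < g (s, w) := by
      intro s hs w hw
      by_contra hneg
      have := hmin (a := (s, w)) ⟨⟨⟨hs.1, hs.2.le.trans ht.2⟩, hw⟩, not_lt.1 hneg⟩
      exact absurd hs.2 (not_lt.2 this)
    simp only at ht hv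
    have hgle' : g (t, v) ≤ 0 := hgle
    have htpos : 0 < t := by
      rcases ht.1.eq_or_lt with h | h
      · exfalso
        subst h
        have h1 := h0.dotProduct_mulVec_nonneg v
        have h2 := hvv v hv
        have h3 : 0 < ε * Real.exp (K * 0) * (v ⬝ᵥ v) := by positivity
        simp only [star_trivial] at h1
        simp only [hg] at hgle'
        linarith
      · exact h
    have hderg : ∀ w : Fin d → ℝ, HasDerivWithinAt (fun s => g (s, w))
        (w ⬝ᵥ (ξ' t *ᵥ w) + ε * (Real.exp (K * t) * K) * (w ⬝ᵥ w)) (Ico 0 t) t := by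
      intro w
      have hd0 : HasDerivWithinAt ξ (ξ' t) (Ico 0 t) t :=
        (hderiv t ht).mono (fun s hs => ⟨hs.1, hs.2.le.trans ht.2⟩)
      have hij : ∀ i j, HasDerivWithinAt (fun s => ξ s i j) (ξ' t i j) (Ico 0 t) t :=
        fun i j => hasDerivWithinAt_pi.1 (hasDerivWithinAt_pi.1 hd0 i) j
      have h1 : HasDerivWithinAt (fun s => w ⬝ᵥ (ξ s *ᵥ w)) (w ⬝ᵥ (ξ' t *ᵥ w)) (Ico 0 t) t := by
        simp only [mulVec, dotProduct]
        exact HasDerivWithinAt.fun_sum fun i _ => (HasDerivWithinAt.fun_sum fun j _ =>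
          (hij i j).mul_const _).const_mul _
      have h2 : HasDerivAt (fun s => Real.exp (K * s)) (Real.exp (K * t) * K) t := by
        simpa using ((hasDerivAt_id t).const_mul K).exp
      exact h1.add (((h2.const_mul ε).mul_const (w ⬝ᵥ w)).hasDerivWithinAt)
    haveI hne : (nhdsWithin t (Ico 0 t)).NeBot := by
      rw [← mem_closure_iff_nhdsWithin_neBot, closure_Ico htpos.ne]
      exact ⟨ht.1, le_rfl⟩
    have hnn : ∀ w ∈ Metric.sphere (0 : Fin d → ℝ) 1, 0 ≤ g (t, w) := by
      intro w hw
      refine ge_of_tendsto (hderg w).continuousWithinAt ?_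
      filter_upwards [self_mem_nhdsWithin] with s hs using (hpos s hs w hw).le
    have hg0 : g (t, v) = 0 := le_antisymm hgle' (hnn v hv)
    have hDle : v ⬝ᵥ (ξ' t *ᵥ v) + ε * (Real.exp (K * t) * K) * (v ⬝ᵥ v) ≤ 0 := by
      have h1 := (hasDerivWithinAt_iff_tendsto_slope' (by simp)).1 (hderg v)
      refine le_of_tendsto h1 ?_
      filter_upwards [self_mem_nhdsWithin] with s hs
      rw [slope_def_field, hg0, sub_zero]
      exact div_nonpos_of_nonneg_of_nonpos (hpos s hs v hv).le (by linarith [hs.2])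
    set l : ℝ := ε * Real.exp (K * t) with hl
    have hlpos : 0 < l := by positivity
    have hl1 : l ≤ 1 := by
      refine le_trans ?_ hε1
      have : K * t ≤ K * T := mul_le_mul_of_nonneg_left ht.2 (by linarith)
      exact mul_le_mul_of_nonneg_left (Real.exp_le_exp.2 this) hε.le
    have hquad : ∀ w, w ⬝ᵥ ((ξ t + l • (1 : Matrix (Fin d) (Fin d) ℝ)) *ᵥ w) = g (t, w) := by
      intro w
      simp [hg, add_mulVec, smul_mulVec, dotProduct_add, hl]
    have hpsd : (ξ t + l • (1 : Matrix (Fin d) (Fin d) ℝ)).PosSemidef := by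
      refine PosSemidef.of_dotProduct_mulVec_nonneg ?_ ?_
      · have := hsymm t ht
        unfold IsSymm at this
        simp [IsHermitian, conjTranspose_eq_transpose_of_trivial, this]
      · intro w
        rw [star_trivial]
        by_cases hw : w = 0
        · simp [hw]
        have hwn : 0 < ‖w‖ := norm_pos_iff.2 hw
        have hu : (‖w‖⁻¹ • w) ∈ Metric.sphere (0 : Fin d → ℝ) 1 := by
          simp [norm_smul, hwn.ne']
        have h1 := hnn _ hu
        rw [← hquad, mulVec_smul, dotProduct_smul, smul_dotProduct, smul_eq_mul, smul_eq_mul] at h1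
        have hi : 0 < ‖w‖⁻¹ := inv_pos.2 hwn
        exact (mul_nonneg_iff_of_pos_left hi).1 ((mul_nonneg_iff_of_pos_left hi).1 h1)
    have hker : ξ t *ᵥ v = -(l • v) := by
      have h1 := (hpsd.dotProduct_mulVec_zero_iff v).1 (by rw [star_trivial, hquad, hg0])
      rw [add_mulVec, smul_mulVec, one_mulVec] at h1
      exact eq_neg_of_add_eq_zero_left h1
    have hker' : v ᵥ* ξ t = -(l • v) := by
      rw [← hker, ← vecMul_transpose, (hsymm t ht)]
    have hR := congrArg (fun M => v ⬝ᵥ (M *ᵥ v)) (hric t ht)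
    simp only [add_mulVec, smul_mulVec, dotProduct_add, ← mulVec_mulVec, hker, dotProduct_smul,
      mulVec_neg, mulVec_smul, dotProduct_neg, smul_eq_mul] at hR
    rw [dotProduct_mulVec v (ξ t), hker'] at hR
    simp only [neg_dotProduct, smul_dotProduct, smul_eq_mul] at hR
    have h1 := hdel.dotProduct_mulVec_nonneg v
    rw [star_trivial] at h1
    have h2 := hB v hv
    have h3 := hvv v hv
    have h4 : l * (v ⬝ᵥ (btil *ᵥ v)) ≤ l * (B * (v ⬝ᵥ v)) := mul_le_mul_of_nonneg_left h2 hlpos.le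
    have h5 : l * (l * (v ⬝ᵥ v)) ≤ 1 * (l * (v ⬝ᵥ v)) :=
      mul_le_mul_of_nonneg_right hl1 (by positivity)
    have h6 : 0 < l * (v ⬝ᵥ v) := by positivity
    have h7 : ε * (Real.exp (K * t) * K) * (v ⬝ᵥ v) = 3 * (l * (v ⬝ᵥ v))
        + 2 * (l * (B * (v ⬝ᵥ v))) := by rw [hl, hK]; ring
    rw [h7] at hDle
    linarith
  intro t ht
  refine PosSemidef.of_dotProduct_mulVec_nonneg ?_ ?_
  · have := hsymm t ht
    unfold IsSymm at this
    simp [IsHermitian, conjTranspose_eq_transpose_of_trivial, this]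
  · intro w
    rw [star_trivial]
    by_cases hw : w = 0
    · simp [hw]
    have hwn : 0 < ‖w‖ := norm_pos_iff.2 hw
    have hu : (‖w‖⁻¹ • w) ∈ Metric.sphere (0 : Fin d → ℝ) 1 := by
      simp [norm_smul, hwn.ne']
    have h1 : 0 ≤ (‖w‖⁻¹ • w) ⬝ᵥ (ξ t *ᵥ (‖w‖⁻¹ • w)) := by
      set u := ‖w‖⁻¹ • w
      have hlim : Filter.Tendsto (fun ε : ℝ => u ⬝ᵥ (ξ t *ᵥ u) + ε * Real.exp (K * t) * (u ⬝ᵥ u))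
          (nhdsWithin 0 (Ioi 0)) (nhds (u ⬝ᵥ (ξ t *ᵥ u))) := by
        have hc : Continuous (fun ε : ℝ =>
            u ⬝ᵥ (ξ t *ᵥ u) + ε * Real.exp (K * t) * (u ⬝ᵥ u)) := by fun_prop
        have := hc.tendsto 0
        simp only [zero_mul, add_zero] at this
        exact this.mono_left nhdsWithin_le_nhds
      refine ge_of_tendsto hlim ?_
      filter_upwards [Ioc_mem_nhdsGT (Real.exp_pos (-(K * T)))] with ε hε
      refine (key ε hε.1 ?_ t ht u hu).le
      calc ε * Real.exp (K * T) ≤ Real.exp (-(K * T)) * Real.exp (K * T) :=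
            mul_le_mul_of_nonneg_right hε.2 (Real.exp_pos _).le
        _ = 1 := by rw [← Real.exp_add]; simp
    rw [mulVec_smul, dotProduct_smul, smul_dotProduct, smul_eq_mul, smul_eq_mul] at h1
    have hi : 0 < ‖w‖⁻¹ := inv_pos.2 hwn
    exact (mul_nonneg_iff_of_pos_left hi).1 ((mul_nonneg_iff_of_pos_left hi).1 h1)
end
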